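/- Assume the HardMax response function with fair tie-breaking (f_resp(0) = 1/2). If principal 1 chooses BayesGreedy, then regardless of principal 2's algorithm, the expected number of agents who choose principal 1 is at least T/2. -/

import Mathlib

/-
A formalization of the Bayesian-choice model of competing bandits.

Two principals each commit to a multi-armed bandit algorithm over a finite set
`A` of arms with Bernoulli rewards.  The mean-reward vector `w : A → ℝ` is drawn
once from a common Bayesian prior `P`.  An algorithm is a map from (reversed)
histories of (arm, reward) pairs to distributions over arms.  Agents arrive
sequentially; agent `t` (rounds are 1-indexed) chooses principal 1 with
probability `fresp (PMR₁(t) - PMR₂(t))`, where `PMRᵢ(t)` is the Bayesian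
posterior mean reward of principal `i`'s next local step; the chosen principal's
algorithm advances one local step.
-/

open MeasureTheory
open scoped Classical

namespace BayesianChoice

/-- A history: a list of (arm, Bernoulli reward) pairs, most recent step first. -/
abbrev History (A : Type) := List (A × Bool)

/-- An MAB algorithm: a distribution over arms, given the observed history.
(Note that such algorithms never depend on the time horizon `T`:
they are automatically `T`-oblivious.) -/
abbrev Alg (A : Type) := History A → PMF A

variable {A : Type} [Fintype A] [Nonempty A]

/-- Likelihood of the reward sequence in history `h`, given mean-reward vector `w`
(rewards are Bernoulli, independent across steps given `w`). -/
noncomputable def lik (w : A → ℝ) : History A → ℝ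
  | [] => 1
  | (a, r) :: h => lik w h * (if r then w a else 1 - w a)

/-- Probability that a stand-alone run of `alg` produces history `h`, given `w`. -/
noncomputable def hProb (alg : Alg A) (w : A → ℝ) : History A → ℝ
  | [] => 1
  | (a, r) :: h => hProb alg w h * ((alg h) a).toReal * (if r then w a else 1 - w a)

variable (P : Measure (A → ℝ))

/-- The prior `P` is supported on mean rewards in `[0,1]` (Bernoulli parameters). -/
def PriorOnUnitCube : Prop := P {w | ∀ a : A, w a ∈ Set.Icc (0:ℝ) 1} = 1

/-- A history is feasible if it has positive marginal likelihood under the prior. -/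
def Feasible (h : History A) : Prop := 0 < ∫ w, lik w h ∂P

/-- Posterior mean reward `E[μ_a | h]` of arm `a` given history `h`. -/
noncomputable def postMean (h : History A) (a : A) : ℝ :=
  (∫ w, w a * lik w h ∂P) / ∫ w, lik w h ∂P

/-- Prior assumption (i): each arm can be the (strictly) best arm. -/
def EachArmCanBeBest : Prop := ∀ a : A, 0 < P {w | ∀ a' : A, a' ≠ a → w a' < w a}

/-- Prior assumption (ii): posterior mean rewards are pairwise distinct
given any feasible history. -/
def DistinctPosteriorMeans : Prop :=
  ∀ h : History A, Feasible P h → ∀ a a' : A, a ≠ a' → postMean P h a ≠ postMean P h a'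

/-- `alg` is (a version of) `BayesGreedy`: on every feasible history it only plays arms
with the largest posterior mean reward. -/
def IsBayesGreedy (alg : Alg A) : Prop :=
  ∀ h : History A, Feasible P h →
    ∀ a ∈ (alg h).support, ∀ a' : A, postMean P h a' ≤ postMean P h a

/-- `alg` is (a version of) `StaticGreedy`: it always plays an arm with the largest
prior mean reward. -/
def IsStaticGreedy (alg : Alg A) : Prop :=
  ∀ h : History A, ∀ a ∈ (alg h).support,
    ∀ a' : A, postMean P ([] : History A) a' ≤ postMean P ([] : History A) a

/-- Marginal probability that a stand-alone run of `alg` produces history `h`. -/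
noncomputable def prH (alg : Alg A) (h : History A) : ℝ := ∫ w, hProb alg w h ∂P

/-- `alg` and `alg'` deviate at (local, 1-indexed) step `n`: there is a set `H` of
histories over the previous `n-1` steps, reached with positive probability by both
algorithms, on which they choose different distributions over arms. -/
def DeviatesAt (alg alg' : Alg A) (n : ℕ) : Prop :=
  ∃ H : Set (History A),
    (∀ h ∈ H, h.length + 1 = n) ∧
    (∃ h ∈ H, 0 < prH P alg h) ∧ (∃ h ∈ H, 0 < prH P alg' h) ∧
    (∀ h ∈ H, alg h ≠ alg' h)

/-- `alg` deviates from `alg'` starting from step `n₀`: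
`n₀` is the smallest step at which they deviate. -/
def DeviatesFrom (alg alg' : Alg A) (n₀ : ℕ) : Prop :=
  DeviatesAt P alg alg' n₀ ∧ ∀ n < n₀, ¬ DeviatesAt P alg alg' n

/-- `E[rew(n)]`: the Bayesian-expected reward collected at local step `n` (1-indexed)
by a stand-alone run of `alg`. -/
noncomputable def rewE (alg : Alg A) (n : ℕ) : ℝ :=
  ∑' h : {h : History A // h.length + 1 = n},
    ∫ w, hProb alg w h.1 * ∑ a : A, ((alg h.1) a).toReal * w a ∂P

/-- `E[max_a μ_a]`: Bayesian-expected reward of the best arm. -/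
noncomputable def optE : ℝ := ∫ w, ⨆ a : A, w a ∂P

/-- Bayesian instantaneous regret of `alg` at local step `n` (stand-alone run). -/
noncomputable def BIR (alg : Alg A) (n : ℕ) : ℝ := optE P - rewE P alg n

/-- `alg` is Bayesian-monotone: its Bayesian-expected reward is non-decreasing in `n`. -/
def BayesianMonotone (alg : Alg A) : Prop :=
  ∀ n m : ℕ, 1 ≤ n → n ≤ m → rewE P alg n ≤ rewE P alg m

/- ### The competition game -/

/-- Bayesian-expected reward of the next local step of `alg`, when the joint
distribution over (mean vector, pair of local histories) has density `g` against `P`,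
and `sel` extracts `alg`'s local history from the pair. -/
noncomputable def nextStepReward (alg : Alg A) (sel : History A × History A → History A)
    (g : (A → ℝ) → History A × History A → ℝ) : ℝ :=
  ∑' s : History A × History A, ∫ w, g w s * ∑ a : A, ((alg (sel s)) a).toReal * w a ∂P

/-- One global round of the game: the current agent chooses principal 1 with
probability `q`; the chosen principal's algorithm advances one local step. -/
noncomputable def stepDist (alg1 alg2 : Alg A) (q : ℝ)
    (g : (A → ℝ) → History A × History A → ℝ) :
    (A → ℝ) → History A × History A → ℝ := fun w s =>
  (match s.1 with
   | [] => 0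
   | (a, r) :: h1' =>
       q * g w (h1', s.2) * ((alg1 h1') a).toReal * (if r then w a else 1 - w a)) +
  (match s.2 with
   | [] => 0
   | (a, r) :: h2' =>
       (1 - q) * g w (s.1, h2') * ((alg2 h2') a).toReal * (if r then w a else 1 - w a))

/-- Joint distribution (density against the prior) over the pair of local histories
after `t` global rounds of the competition game, when the principals play
`(alg1, alg2)` and agents respond via `fresp`. -/
noncomputable def gameDist (alg1 alg2 : Alg A) (fresp : ℝ → ℝ) :
    ℕ → (A → ℝ) → History A × History A → ℝ
  | 0 => fun _ s => if s = (([] : History A), ([] : History A)) then 1 else 0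
  | t + 1 =>
      stepDist alg1 alg2
        (fresp (nextStepReward P alg1 Prod.fst (gameDist alg1 alg2 fresp t) -
                nextStepReward P alg2 Prod.snd (gameDist alg1 alg2 fresp t)))
        (gameDist alg1 alg2 fresp t)

/-- `PMR₁(t) = E[r_t | i_t = 1] = E[rew_1(n_1(t)+1)]`: posterior mean reward of
principal 1 at global round `t` (rounds are 1-indexed). -/
noncomputable def PMR1 (alg1 alg2 : Alg A) (fresp : ℝ → ℝ) (t : ℕ) : ℝ :=
  nextStepReward P alg1 Prod.fst (gameDist P alg1 alg2 fresp (t - 1))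

/-- `PMR₂(t)`: posterior mean reward of principal 2 at global round `t`. -/
noncomputable def PMR2 (alg1 alg2 : Alg A) (fresp : ℝ → ℝ) (t : ℕ) : ℝ :=
  nextStepReward P alg2 Prod.snd (gameDist P alg1 alg2 fresp (t - 1))

/-- Probability that agent `t` chooses principal 1:
`Pr[i_t = 1] = fresp (PMR₁(t) - PMR₂(t))`. -/
noncomputable def probChoose1 (alg1 alg2 : Alg A) (fresp : ℝ → ℝ) (t : ℕ) : ℝ :=
  fresp (PMR1 P alg1 alg2 fresp t - PMR2 P alg1 alg2 fresp t)

/-- Expected number of the `T` agents that choose principal 1 (principal 1's utility). -/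
noncomputable def marketShare1 (alg1 alg2 : Alg A) (fresp : ℝ → ℝ) (T : ℕ) : ℝ :=
  ∑ t ∈ Finset.Icc 1 T, probChoose1 P alg1 alg2 fresp t

/-- Expected number of the `T` agents that choose principal 2 (principal 2's utility). -/
noncomputable def marketShare2 (alg1 alg2 : Alg A) (fresp : ℝ → ℝ) (T : ℕ) : ℝ :=
  ∑ t ∈ Finset.Icc 1 T, (1 - probChoose1 P alg1 alg2 fresp t)

/-- `(a1, a2)` is a (pure) Nash equilibrium of the competition game with horizon `T`,
response function `fresp`, and feasible strategy set `F`; each principal's utility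
is the expected number of agents who choose her. -/
def IsNash (F : Set (Alg A)) (fresp : ℝ → ℝ) (T : ℕ) (a1 a2 : Alg A) : Prop :=
  a1 ∈ F ∧ a2 ∈ F ∧
  (∀ a1' ∈ F, marketShare1 P a1' a2 fresp T ≤ marketShare1 P a1 a2 fresp T) ∧
  (∀ a2' ∈ F, marketShare2 P a1 a2' fresp T ≤ marketShare2 P a1 a2 fresp T)

/- ### Response functions -/

/-- `HardMax` response function (its value at `0` — the tie-breaking rule —
is specified separately). -/
def IsHardMax (f : ℝ → ℝ) : Prop :=
  (∀ x : ℝ, 0 < x → f x = 1) ∧ (∀ x : ℝ, x < 0 → f x = 0)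

/-- `HardMax&Random` response function with baseline probability `ε₀ = f(-1)`. -/
def IsHardMaxRandom (f : ℝ → ℝ) (ε₀ : ℝ) : Prop :=
  ε₀ ∈ Set.Ioo (0:ℝ) (1/2 : ℝ) ∧ f (-1) = ε₀ ∧
  (∀ x : ℝ, 0 < x → f x = 1 - ε₀) ∧ (∀ x : ℝ, x < 0 → f x = ε₀)

/-- A symmetric response function: `f(x) + f(-x) = 1` for all `x ∈ [0,1]`. -/
def SymmetricResp (f : ℝ → ℝ) : Prop := ∀ x ∈ Set.Icc (0:ℝ) 1, f x + f (-x) = 1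

/-- `SoftMax` response function with smoothness constants `δ₀, c₀, c₀'`. -/
def IsSoftMax (f : ℝ → ℝ) (δ₀ c₀ c₀' : ℝ) : Prop :=
  (∃ ε ∈ Set.Ioo (0:ℝ) (1/2 : ℝ), ∀ x : ℝ, f x ∈ Set.Icc ε (1 - ε)) ∧
  f 0 = 1/2 ∧ 0 < δ₀ ∧ 0 < c₀ ∧ 0 < c₀' ∧
  ∀ x ∈ Set.Icc (-δ₀) δ₀, DifferentiableAt ℝ f x ∧ c₀ ≤ deriv f x ∧ deriv f x ≤ c₀'

/-- `alg1` BIR-dominates `alg2` starting from step `n₀`: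
`BIR₁(ε₀ n / 2) / BIR₂(n) < 1/2` for all `n ≥ n₀`. -/
def BIRDominates (alg1 alg2 : Alg A) (ε₀ : ℝ) (n₀ : ℕ) : Prop :=
  ∀ n : ℕ, n₀ ≤ n → BIR P alg1 ⌊ε₀ * n / 2⌋₊ / BIR P alg2 n < 1/2

/-- `alg1` weakly BIR-dominates `alg2` with constants `β₀, α₀ ∈ (0,1/2)`, from step `n₀`:
`BIR₁((1-β₀) n) / BIR₂(n) < 1 - α₀` for all `n ≥ n₀`. -/
def WeakBIRDominates (alg1 alg2 : Alg A) (β₀ α₀ : ℝ) (n₀ : ℕ) : Prop :=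
  ∀ n : ℕ, n₀ ≤ n → BIR P alg1 ⌊(1 - β₀) * n⌋₊ / BIR P alg2 n < 1 - α₀

end BayesianChoice

namespace BayesianChoice

open MeasureTheory


section helpers

set_option linter.unusedSectionVars false

variable {A : Type} [Fintype A]

/-- Finset of histories of length `n`. -/
noncomputable def histF (A : Type) [Fintype A] : ℕ → Finset (History A)
  | 0 => {[]}
  | n + 1 => ((Finset.univ : Finset (A × Bool)) ×ˢ histF A n).image (fun p => p.1 :: p.2)

lemma mem_histF (n : ℕ) (h : History A) : h ∈ histF A n ↔ h.length = n := by
  induction n generalizing h with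
  | zero => simp [histF]
  | succ n ih =>
    simp only [histF, Finset.mem_image, Finset.mem_product, Finset.mem_univ, true_and]
    constructor
    · rintro ⟨p, hp, rfl⟩
      simp [(ih _).1 hp]
    · intro hh
      cases h with
      | nil => simp at hh
      | cons x h =>
        refine ⟨(x, h), (ih _).2 ?_, rfl⟩
        simpa using hh

lemma sum_histF_succ (n : ℕ) (f : History A → ℝ) :
    ∑ h ∈ histF A (n+1), f h =
      ∑ h ∈ histF A n, ∑ a : A, (f ((a, true) :: h) + f ((a, false) :: h)) := by
  rw [histF, Finset.sum_image, Finset.sum_product_right]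
  · refine Finset.sum_congr rfl fun h _ => ?_
    rw [Fintype.sum_prod_type]
    refine Finset.sum_congr rfl fun a _ => ?_
    simp
  · rintro ⟨x, h⟩ _ ⟨y, h'⟩ _ heq
    simp only [List.cons.injEq] at heq
    ext1 <;> simp [heq.1, heq.2]

lemma pmf_sum (p : PMF A) : ∑ a, (p a).toReal = 1 := by
  rw [← ENNReal.toReal_sum (fun a _ => p.apply_ne_top a), ← tsum_fintype (L := .unconditional _), p.tsum_coe]
  simp

lemma pmf_nonneg (p : PMF A) (a : A) : 0 ≤ (p a).toReal := ENNReal.toReal_nonneg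

/-- Product of the algorithm's choice probabilities. -/
noncomputable def algPr (alg : Alg A) : History A → ℝ
  | [] => 1
  | (a, _) :: h => algPr alg h * ((alg h) a).toReal

lemma algPr_nonneg (alg : Alg A) (h : History A) : 0 ≤ algPr alg h := by
  induction h with
  | nil => simp [algPr]
  | cons x h ih => exact mul_nonneg ih ENNReal.toReal_nonneg

lemma hProb_eq (alg : Alg A) (w : A → ℝ) (h : History A) :
    hProb alg w h = algPr alg h * lik w h := by
  induction h with
  | nil => simp [hProb, algPr, lik]
  | cons x h ih =>
    obtain ⟨a, r⟩ := x
    simp only [hProb, algPr, lik, ih]; ring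

lemma sum_hProb (alg : Alg A) (w : A → ℝ) (n : ℕ) : ∑ h ∈ histF A n, hProb alg w h = 1 := by
  induction n with
  | zero => simp [histF, hProb]
  | succ n ih =>
    rw [sum_histF_succ, ← ih]
    refine Finset.sum_congr rfl fun h _ => ?_
    calc _ = ∑ a, hProb alg w h * ((alg h) a).toReal := by
            refine Finset.sum_congr rfl fun a _ => ?_
            simp [hProb]; ring
      _ = _ := by rw [← Finset.mul_sum, pmf_sum, mul_one]

lemma cont_lik (h : History A) : Continuous (fun w : A → ℝ => lik w h) := by
  induction h with
  | nil => simp only [lik]; fun_prop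
  | cons x h ih =>
    obtain ⟨a, r⟩ := x
    cases r <;> simp only [lik] <;> simp <;> fun_prop

lemma cont_hProb (alg : Alg A) (h : History A) : Continuous (fun w : A → ℝ => hProb alg w h) := by
  simp only [hProb_eq]
  exact continuous_const.mul (cont_lik h)

variable (P : Measure (A → ℝ))

lemma ae_cube [IsProbabilityMeasure P] (hcube : PriorOnUnitCube P) :
    ∀ᵐ w ∂P, ∀ a : A, w a ∈ Set.Icc (0:ℝ) 1 := by
  have hm : MeasurableSet {w : A → ℝ | ∀ a : A, w a ∈ Set.Icc (0:ℝ) 1} := by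
    have : {w : A → ℝ | ∀ a : A, w a ∈ Set.Icc (0:ℝ) 1} = Set.univ.pi fun _ => Set.Icc (0:ℝ) 1 := by
      ext; simp only [Set.mem_pi, Set.mem_setOf_eq, Set.mem_univ, true_implies]
    rw [this]
    exact MeasurableSet.univ_pi fun _ => measurableSet_Icc
  exact (prob_compl_eq_zero_iff hm).2 hcube

lemma integ [IsProbabilityMeasure P] (hcube : PriorOnUnitCube P) {F : (A → ℝ) → ℝ}
    (hF : Continuous F) : Integrable F P := by
  have hc : IsCompact (Set.univ.pi fun _ : A => Set.Icc (0:ℝ) 1) :=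
    isCompact_univ_pi fun _ => isCompact_Icc
  have h1 : IntegrableOn F (Set.univ.pi fun _ : A => Set.Icc (0:ℝ) 1) P :=
    hF.continuousOn.integrableOn_compact hc
  rwa [IntegrableOn, Measure.restrict_eq_self_of_ae_mem] at h1
  filter_upwards [ae_cube P hcube] with w hw
  exact fun a _ => hw a

lemma lik_nonneg {w : A → ℝ} (hw : ∀ a : A, w a ∈ Set.Icc (0:ℝ) 1) (h : History A) :
    0 ≤ lik w h := by
  induction h with
  | nil => simp [lik]
  | cons x h ih =>
    obtain ⟨a, r⟩ := x
    refine mul_nonneg ih ?_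
    have := hw a
    split_ifs
    · exact this.1
    · linarith [this.2]

/-- Unnormalized posterior mean. -/
noncomputable def NN (h : History A) (a : A) : ℝ := ∫ w, w a * lik w h ∂P

/-- Marginal likelihood. -/
noncomputable def ZZ (h : History A) : ℝ := ∫ w, lik w h ∂P

/-- Unnormalized value of the next step. -/
noncomputable def VV (alg : Alg A) (h : History A) : ℝ := ∑ a, ((alg h) a).toReal * NN P h a

/-- Expected reward at local step `n+1`. -/
noncomputable def RR (alg : Alg A) (n : ℕ) : ℝ := ∑ h ∈ histF A n, algPr alg h * VV P alg h

section
variable [IsProbabilityMeasure P] (hcube : PriorOnUnitCube P)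
include hcube

lemma ZZ_nonneg (h : History A) : 0 ≤ ZZ P h := by
  refine integral_nonneg_of_ae ?_
  filter_upwards [ae_cube P hcube] with w hw using lik_nonneg hw h

lemma lik_zero_of_ZZ {h : History A} (hz : ZZ P h = 0) : ∀ᵐ w ∂P, lik w h = 0 := by
  have := (integral_eq_zero_iff_of_nonneg_ae (μ := P) (f := fun w => lik w h) ?_
    (integ P hcube (cont_lik h))).1 hz
  · exact this
  · filter_upwards [ae_cube P hcube] with w hw using lik_nonneg hw h

lemma NN_zero {h : History A} (hz : ZZ P h = 0) (a : A) : NN P h a = 0 := by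
  refine integral_eq_zero_of_ae ?_
  filter_upwards [lik_zero_of_ZZ P hcube hz] with w hw
  simp [hw]

lemma ZZ_cons_zero {h : History A} (hz : ZZ P h = 0) (x : A × Bool) : ZZ P (x :: h) = 0 := by
  refine integral_eq_zero_of_ae ?_
  filter_upwards [lik_zero_of_ZZ P hcube hz] with w hw
  obtain ⟨a, r⟩ := x
  simp [lik, hw]

lemma NN_split (h : History A) (a b : A) :
    NN P ((a, true) :: h) b + NN P ((a, false) :: h) b = NN P h b := by
  have hc := cont_lik (A := A)
  unfold NN
  rw [← integral_add]
  · refine integral_congr_ae (Filter.Eventually.of_forall fun w => ?_)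
    simp [lik]; ring
  · exact integ P hcube ((continuous_apply b).mul (hc _))
  · exact integ P hcube ((continuous_apply b).mul (hc _))

lemma int_V (alg : Alg A) (h : History A) :
    ∫ w, hProb alg w h * ∑ a : A, ((alg h) a).toReal * w a ∂P = algPr alg h * VV P alg h := by
  have : ∀ w : A → ℝ, hProb alg w h * ∑ a : A, ((alg h) a).toReal * w a =
      ∑ a : A, (algPr alg h * ((alg h) a).toReal) * (w a * lik w h) := by
    intro w
    rw [hProb_eq, Finset.mul_sum]
    exact Finset.sum_congr rfl fun a _ => by ring
  simp only [this]
  rw [integral_finsetSum]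
  · simp only [integral_const_mul, VV, Finset.mul_sum, NN, mul_assoc]
  · intro a _
    exact integ P hcube (continuous_const.mul ((continuous_apply a).mul (cont_lik h)))

variable {alg1 : Alg A} (hBG : IsBayesGreedy P alg1)
include hBG

lemma NN_max {h : History A} (a : A) (ha : a ∈ (alg1 h).support) (b : A) :
    NN P h b ≤ NN P h a := by
  rcases (ZZ_nonneg P hcube h).eq_or_lt with hz | hz
  · rw [NN_zero P hcube hz.symm, NN_zero P hcube hz.symm]
  · have := hBG h hz a ha b
    unfold postMean at this
    exact (div_le_div_iff_of_pos_right hz).1 this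

lemma NN_le_VV (h : History A) (b : A) : NN P h b ≤ VV P alg1 h := by
  calc NN P h b = ∑ a, ((alg1 h) a).toReal * NN P h b := by
        rw [← Finset.sum_mul, pmf_sum, one_mul]
    _ ≤ VV P alg1 h := by
      refine Finset.sum_le_sum fun a _ => ?_
      by_cases ha : a ∈ (alg1 h).support
      · exact mul_le_mul_of_nonneg_left (NN_max P hcube hBG a ha b) (pmf_nonneg _ _)
      · rw [PMF.mem_support_iff, not_not] at ha
        simp [ha]

lemma VV_le (alg : Alg A) (h : History A) : VV P alg h ≤ VV P alg1 h := by
  calc VV P alg h ≤ ∑ a, ((alg h) a).toReal * VV P alg1 h :=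
        Finset.sum_le_sum fun a _ =>
          mul_le_mul_of_nonneg_left (NN_le_VV P hcube hBG h a) (pmf_nonneg _ _)
    _ = _ := by rw [← Finset.sum_mul, pmf_sum, one_mul]

lemma RR_mono (n : ℕ) : RR P alg1 n ≤ RR P alg1 (n+1) := by
  unfold RR
  rw [sum_histF_succ]
  refine Finset.sum_le_sum fun h _ => ?_
  have key : ∀ a, VV P alg1 h ≤ VV P alg1 ((a, true) :: h) + VV P alg1 ((a, false) :: h) := by
    intro a
    calc VV P alg1 h ≤ ∑ b, ((alg1 h) b).toReal *
          (VV P alg1 ((a, true) :: h) + VV P alg1 ((a, false) :: h)) := by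
            refine Finset.sum_le_sum fun b _ => mul_le_mul_of_nonneg_left ?_ (pmf_nonneg _ _)
            rw [← NN_split P hcube h a b]
            exact add_le_add (NN_le_VV P hcube hBG _ b) (NN_le_VV P hcube hBG _ b)
      _ = _ := by rw [← Finset.sum_mul, pmf_sum, one_mul]
  calc algPr alg1 h * VV P alg1 h
      = ∑ a, algPr alg1 h * ((alg1 h) a).toReal * VV P alg1 h := by
        rw [← Finset.sum_mul, ← Finset.mul_sum, pmf_sum, mul_one]
    _ ≤ _ := by
      refine Finset.sum_le_sum fun a _ => ?_
      simp only [algPr]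
      rw [← mul_add]
      exact mul_le_mul_of_nonneg_left (key a) (mul_nonneg (algPr_nonneg _ _) (pmf_nonneg _ _))

lemma pmf_eq_of_supp (p q : PMF A) (c : A) (hp : ∀ a, p a ≠ 0 → a = c)
    (hq : ∀ a, q a ≠ 0 → a = c) (a : A) : (p a).toReal = (q a).toReal := by
  have key : ∀ p : PMF A, (∀ a, p a ≠ 0 → a = c) → (p a).toReal = if a = c then 1 else 0 := by
    intro p hp
    split_ifs with h
    · rw [← pmf_sum p, h]
      symm
      refine Finset.sum_eq_single c (fun b _ hb => ?_) (by simp)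
      have : p b = 0 := by by_contra h0; exact hb (hp b h0)
      simp [this]
    · have : p a = 0 := by by_contra h0; exact h (hp a h0)
      simp [this]
  rw [key p hp, key q hq]

lemma alg_eq (hdistinct : DistinctPosteriorMeans P) (alg2 : Alg A) {h : History A}
    (hz : 0 < ZZ P h) (hV : VV P alg2 h = VV P alg1 h) (a : A) :
    ((alg2 h) a).toReal = ((alg1 h) a).toReal := by
  obtain ⟨c, hc⟩ := (alg1 h).support_nonempty
  have hcV : NN P h c = VV P alg1 h := by
    refine le_antisymm (NN_le_VV P hcube hBG h c) ?_
    calc VV P alg1 h ≤ ∑ a, ((alg1 h) a).toReal * NN P h c :=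
          Finset.sum_le_sum fun b _ =>
            mul_le_mul_of_nonneg_left (NN_max P hcube hBG c hc b) (pmf_nonneg _ _)
      _ = _ := by rw [← Finset.sum_mul, pmf_sum, one_mul]
  have huniq : ∀ b, NN P h b = VV P alg1 h → b = c := by
    intro b hb
    by_contra hne
    refine hdistinct h hz b c hne ?_
    have : NN P h b = NN P h c := hb.trans hcV.symm
    unfold NN at this
    unfold postMean
    rw [this]
  have hsupp : ∀ alg : Alg A, VV P alg h = VV P alg1 h → ∀ b, (alg h) b ≠ 0 → b = c := by
    intro alg hE b hb
    refine huniq b ?_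
    have hle : ∀ i ∈ Finset.univ, ((alg h) i).toReal * NN P h i
        ≤ ((alg h) i).toReal * VV P alg1 h := fun i _ =>
      mul_le_mul_of_nonneg_left (NN_le_VV P hcube hBG h i) (pmf_nonneg _ _)
    have hs : ∑ i, ((alg h) i).toReal * NN P h i = ∑ i, ((alg h) i).toReal * VV P alg1 h := by
      rw [← Finset.sum_mul, pmf_sum, one_mul]; exact hE
    have := (Finset.sum_eq_sum_iff_of_le hle).1 hs b (Finset.mem_univ b)
    exact mul_left_cancel₀ (ENNReal.toReal_ne_zero.2 ⟨hb, PMF.apply_ne_top _ _⟩) this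
  exact pmf_eq_of_supp P hcube hBG _ _ c (hsupp alg2 hV) (hsupp alg1 rfl) a

lemma VV_zero {h : History A} (alg : Alg A) (hz : ZZ P h = 0) : VV P alg h = 0 := by
  unfold VV
  exact Finset.sum_eq_zero fun a _ => by rw [NN_zero P hcube hz, mul_zero]

lemma sum_pi_eq (alg2 : Alg A) (n : ℕ)
    (hI : ∀ h ∈ histF A n, algPr alg2 h * ZZ P h = algPr alg1 h * ZZ P h) :
    RR P alg1 n = ∑ h ∈ histF A n, algPr alg2 h * VV P alg1 h := by
  refine Finset.sum_congr rfl fun h hh => ?_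
  by_cases hz : ZZ P h = 0
  · rw [VV_zero P hcube hBG alg1 hz]; simp
  · rw [mul_right_cancel₀ hz (hI h hh)]

lemma RR_inv (hdistinct : DistinctPosteriorMeans P) (alg2 : Alg A) (n : ℕ)
    (hR : ∀ k < n, RR P alg1 k = RR P alg2 k) :
    ∀ h ∈ histF A n, algPr alg2 h * ZZ P h = algPr alg1 h * ZZ P h := by
  induction n with
  | zero => intro h hh; simp [histF] at hh; subst hh; simp [algPr]
  | succ n ih =>
    have hI := ih fun k hk => hR k (by omega)
    have hRn := hR n (by omega)
    rw [sum_pi_eq P hcube hBG alg2 n hI] at hRn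
    have hterm := (Finset.sum_eq_sum_iff_of_le (fun h _ =>
      mul_le_mul_of_nonneg_left (VV_le P hcube hBG alg2 h) (algPr_nonneg alg2 h))).1 hRn.symm
    intro h' hh'
    rw [mem_histF] at hh'
    cases h' with
    | nil => simp at hh'
    | cons x h =>
      have hh : h ∈ histF A n := (mem_histF _ _).2 (by simpa using hh')
      by_cases hz : ZZ P h = 0
      · rw [ZZ_cons_zero P hcube hz]; simp
      · have hpi := mul_right_cancel₀ hz (hI h hh)
        obtain ⟨a, r⟩ := x
        simp only [algPr]
        by_cases hp : algPr alg2 h = 0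
        · rw [← hpi, hp]; simp
        · rw [← hpi, alg_eq P hcube hBG hdistinct alg2
            (lt_of_le_of_ne (ZZ_nonneg P hcube h) (Ne.symm hz))
            (mul_left_cancel₀ hp (hterm h hh))]

lemma RR_opt (hdistinct : DistinctPosteriorMeans P) (alg2 : Alg A) (n : ℕ)
    (hR : ∀ k < n, RR P alg1 k = RR P alg2 k) : RR P alg2 n ≤ RR P alg1 n := by
  rw [sum_pi_eq P hcube hBG alg2 n (RR_inv P hcube hBG hdistinct alg2 n hR)]
  exact Finset.sum_le_sum fun h _ =>
      mul_le_mul_of_nonneg_left (VV_le P hcube hBG alg2 h) (algPr_nonneg alg2 h)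

end

/-- Distribution of the pair of local clocks. -/
noncomputable def cnt (q : ℕ → ℝ) : ℕ → ℕ → ℕ → ℝ
  | 0 => fun n m => if n = 0 ∧ m = 0 then 1 else 0
  | t + 1 => fun n m =>
      (match n with
       | 0 => 0
       | n' + 1 => q t * cnt q t n' m) +
      (match m with
       | 0 => 0
       | m' + 1 => (1 - q t) * cnt q t n m')

lemma cnt_supp (q : ℕ → ℝ) (t n m : ℕ) (h : n + m ≠ t) : cnt q t n m = 0 := by
  induction t generalizing n m with
  | zero =>
    have : ¬ (n = 0 ∧ m = 0) := by omega
    simp [cnt, this]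
  | succ t ih =>
    cases n with
    | zero =>
      cases m with
      | zero => simp [cnt]
      | succ m => simp [cnt, ih 0 m (by omega)]
    | succ n =>
      cases m with
      | zero => simp [cnt, ih n 0 (by omega)]
      | succ m => simp [cnt, ih n (m+1) (by omega), ih (n+1) m (by omega)]

lemma cnt_nonneg (q : ℕ → ℝ) (t : ℕ) (hq : ∀ s < t, 0 ≤ q s ∧ q s ≤ 1) (n m : ℕ) :
    0 ≤ cnt q t n m := by
  induction t generalizing n m with
  | zero => simp only [cnt]; split_ifs <;> norm_num
  | succ t ih =>
    have ih' := ih fun s hs => hq s (by omega)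
    have h0 := (hq t (by omega)).1
    have h1 : 0 ≤ 1 - q t := by linarith [(hq t (by omega)).2]
    simp only [cnt]
    refine add_nonneg ?_ ?_
    · cases n with
      | zero => simp
      | succ n => exact mul_nonneg h0 (ih' _ _)
    · cases m with
      | zero => simp
      | succ m => exact mul_nonneg h1 (ih' _ _)

lemma cnt_symm (q : ℕ → ℝ) (t : ℕ) (hq : ∀ s < t, q s = 1/2) (n m : ℕ) :
    cnt q t n m = cnt q t m n := by
  induction t generalizing n m with
  | zero => simp only [cnt, and_comm]
  | succ t ih =>
    have ih' := ih fun s hs => hq s (by omega)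
    have h0 := hq t (by omega)
    cases n <;> cases m <;> simp only [cnt, h0]
    · rw [ih']; ring
    · rw [ih']; ring
    · rename_i n m
      rw [ih' n, ih' (n+1)]; ring

lemma cnt_pos (q : ℕ → ℝ) (t : ℕ) (hq : ∀ s < t, q s = 1/2) : 0 < cnt q t t 0 := by
  induction t with
  | zero => simp [cnt]
  | succ t ih =>
    have ih' := ih fun s hs => hq s (by omega)
    have h0 := hq t (by omega)
    simp only [cnt, h0]
    linarith

lemma cnt_one_sum (q : ℕ → ℝ) (t : ℕ) (hq : q t = 1) (f : ℕ → ℕ → ℝ) :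
    ∑ p ∈ Finset.HasAntidiagonal.antidiagonal (t+1), cnt q (t+1) p.1 p.2 * f p.1 p.2 =
      ∑ p ∈ Finset.HasAntidiagonal.antidiagonal t, cnt q t p.1 p.2 * f (p.1+1) p.2 := by
  rw [Finset.Nat.sum_antidiagonal_succ]
  have h0 : cnt q (t+1) 0 (t+1) = 0 := by simp [cnt, hq]
  simp only [h0, zero_mul, zero_add]
  refine Finset.sum_congr rfl fun p _ => ?_
  congr 1
  simp only [cnt, hq]
  cases p.2 <;> simp

/-- The choice probability at round `t+1`. -/
noncomputable def qq (alg1 alg2 : Alg A) (fresp : ℝ → ℝ) (t : ℕ) : ℝ :=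
  fresp (nextStepReward P alg1 Prod.fst (gameDist P alg1 alg2 fresp t) -
    nextStepReward P alg2 Prod.snd (gameDist P alg1 alg2 fresp t))

lemma gameDist_eq (alg1 alg2 : Alg A) (fresp : ℝ → ℝ) (t : ℕ) (w : A → ℝ)
    (s : History A × History A) :
    gameDist P alg1 alg2 fresp t w s =
      cnt (qq P alg1 alg2 fresp) t s.1.length s.2.length * hProb alg1 w s.1 * hProb alg2 w s.2 := by
  induction t generalizing s with
  | zero =>
    obtain ⟨h1, h2⟩ := s
    cases h1 <;> cases h2 <;> simp [gameDist, cnt, hProb]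
  | succ t ih =>
    obtain ⟨h1, h2⟩ := s
    rw [gameDist]
    change stepDist alg1 alg2 (qq P alg1 alg2 fresp t) _ w _ = _
    unfold stepDist
    rcases h1 with _ | ⟨⟨a, r⟩, h1⟩ <;> rcases h2 with _ | ⟨⟨b, r'⟩, h2⟩ <;>
      simp only [ih, cnt, hProb, List.length_nil, List.length_cons] <;> ring

section
variable [IsProbabilityMeasure P] (hcube : PriorOnUnitCube P)
include hcube

lemma tsum_game (t : ℕ) (G : History A × History A → ℝ)
    (hG : ∀ s, s.1.length + s.2.length ≠ t → G s = 0) :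
    ∑' s, G s = ∑ p ∈ Finset.HasAntidiagonal.antidiagonal t, ∑ h1 ∈ histF A p.1, ∑ h2 ∈ histF A p.2, G (h1, h2) := by
  rw [tsum_eq_sum (s := (Finset.HasAntidiagonal.antidiagonal t).biUnion fun p => histF A p.1 ×ˢ histF A p.2)]
  · rw [Finset.sum_biUnion]
    · exact Finset.sum_congr rfl fun p _ => Finset.sum_product _ _ _
    · intro p _ p' _ hne
      refine Finset.disjoint_left.2 fun s hs hs' => hne ?_
      simp only [Finset.mem_product, mem_histF] at hs hs'
      ext
      · exact hs.1.symm.trans hs'.1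
      · exact hs.2.symm.trans hs'.2
  · intro s hs
    refine hG s fun h => hs ?_
    simp only [Finset.mem_biUnion, Finset.mem_product, mem_histF, Finset.HasAntidiagonal.mem_antidiagonal]
    exact ⟨(s.1.length, s.2.length), h, rfl, rfl⟩

lemma next1 (alg1 alg2 : Alg A) (fresp : ℝ → ℝ) (t : ℕ) :
    nextStepReward P alg1 Prod.fst (gameDist P alg1 alg2 fresp t) =
      ∑ p ∈ Finset.HasAntidiagonal.antidiagonal t, cnt (qq P alg1 alg2 fresp) t p.1 p.2 * RR P alg1 p.1 := by
  unfold nextStepReward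
  rw [tsum_game P hcube t]
  · refine Finset.sum_congr rfl fun p _ => ?_
    rw [RR, Finset.mul_sum]
    refine Finset.sum_congr rfl fun h1 hh1 => ?_
    rw [← integral_finsetSum, ← int_V P hcube, ← integral_const_mul]
    · refine integral_congr_ae (Filter.Eventually.of_forall fun w => ?_)
      simp only [gameDist_eq]
      rw [← Finset.sum_mul, ← mul_assoc]
      congr 1
      calc _ = ∑ h2 ∈ histF A p.2, cnt (qq P alg1 alg2 fresp) t p.1 p.2 * hProb alg1 w h1 *
                hProb alg2 w h2 := by
              refine Finset.sum_congr rfl fun h2 hh2 => ?_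
              rw [(mem_histF _ _).1 hh1, (mem_histF _ _).1 hh2]
        _ = _ := by rw [← Finset.mul_sum, sum_hProb, mul_one]
    · intro h2 _
      refine integ P hcube ?_
      simp only [gameDist_eq]
      have := cont_hProb alg1 h1
      have := cont_hProb alg2 h2
      fun_prop
  · intro s hs
    simp [gameDist_eq, cnt_supp _ _ _ _ hs]

lemma next2 (alg1 alg2 : Alg A) (fresp : ℝ → ℝ) (t : ℕ) :
    nextStepReward P alg2 Prod.snd (gameDist P alg1 alg2 fresp t) =
      ∑ p ∈ Finset.HasAntidiagonal.antidiagonal t, cnt (qq P alg1 alg2 fresp) t p.1 p.2 * RR P alg2 p.2 := by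
  unfold nextStepReward
  rw [tsum_game P hcube t]
  · refine Finset.sum_congr rfl fun p _ => ?_
    rw [RR, Finset.mul_sum, Finset.sum_comm]
    refine Finset.sum_congr rfl fun h2 hh2 => ?_
    rw [← integral_finsetSum, ← int_V P hcube, ← integral_const_mul]
    · refine integral_congr_ae (Filter.Eventually.of_forall fun w => ?_)
      simp only [gameDist_eq]
      rw [← Finset.sum_mul, ← mul_assoc]
      congr 1
      calc _ = ∑ h1 ∈ histF A p.1, cnt (qq P alg1 alg2 fresp) t p.1 p.2 * hProb alg2 w h2 *
                hProb alg1 w h1 := by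
              refine Finset.sum_congr rfl fun h1 hh1 => ?_
              rw [(mem_histF _ _).1 hh1, (mem_histF _ _).1 hh2]; ring
        _ = _ := by rw [← Finset.mul_sum, sum_hProb, mul_one]
    · intro h1 _
      refine integ P hcube ?_
      simp only [gameDist_eq]
      have := cont_hProb alg1 h1
      have := cont_hProb alg2 h2
      fun_prop
  · intro s hs
    simp [gameDist_eq, cnt_supp _ _ _ _ hs]

end

/-- Abstract dynamics: the choice probabilities are always at least `1/2`. -/
lemma dyn (f : ℝ → ℝ) (hHM : IsHardMax f) (htie : f 0 = 1/2) (q : ℕ → ℝ) (R1 R2 : ℕ → ℝ)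
    (hmono : ∀ n, R1 n ≤ R1 (n+1))
    (hopt : ∀ n, (∀ k < n, R1 k = R2 k) → R2 n ≤ R1 n)
    (hq : ∀ t, q t = f (∑ p ∈ Finset.HasAntidiagonal.antidiagonal t, cnt q t p.1 p.2 * R1 p.1 -
      ∑ p ∈ Finset.HasAntidiagonal.antidiagonal t, cnt q t p.1 p.2 * R2 p.2)) (t : ℕ) : 1/2 ≤ q t := by
  set D : ℕ → ℝ := fun t => ∑ p ∈ Finset.HasAntidiagonal.antidiagonal t, cnt q t p.1 p.2 * R1 p.1 -
      ∑ p ∈ Finset.HasAntidiagonal.antidiagonal t, cnt q t p.1 p.2 * R2 p.2 with hD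
  have hq' : ∀ t, q t = f (D t) := hq
  have hq01 : ∀ t, 0 ≤ q t ∧ q t ≤ 1 := by
    intro t
    rw [hq']
    rcases lt_trichotomy (D t) 0 with h | h | h
    · rw [hHM.2 _ h]; norm_num
    · rw [h, htie]; norm_num
    · rw [hHM.1 _ h]; norm_num
  have hD0 : ∀ t, q t = 1/2 → D t = 0 := by
    intro t ht
    rw [hq'] at ht
    rcases lt_trichotomy (D t) 0 with h | h | h
    · rw [hHM.2 _ h] at ht; norm_num at ht
    · exact h
    · rw [hHM.1 _ h] at ht; norm_num at ht
  have hDt : ∀ t, (∀ s < t, q s = 1/2) → (∀ k < t, R1 k = R2 k) →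
      D t = cnt q t t 0 * (R1 t - R2 t) := by
    intro t hs hR
    have e2 : ∑ p ∈ Finset.HasAntidiagonal.antidiagonal t, cnt q t p.1 p.2 * R2 p.2 =
        ∑ p ∈ Finset.HasAntidiagonal.antidiagonal t, cnt q t p.1 p.2 * R2 p.1 := by
      rw [← Finset.Nat.sum_antidiagonal_swap]
      refine Finset.sum_congr rfl fun p _ => ?_
      simp only [Prod.fst_swap, Prod.snd_swap]
      rw [cnt_symm q t hs]
    simp only [hD]
    rw [e2, ← Finset.sum_sub_distrib, Finset.sum_eq_single (t, 0)]
    · simp only []; ring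
    · intro p hp hne
      rw [Finset.HasAntidiagonal.mem_antidiagonal] at hp
      have : p.1 < t := by
        by_contra hc
        apply hne
        ext <;> simp <;> omega
      rw [hR _ this]; ring
    · intro hn; simp at hn
  have hRs : ∀ t, (∀ s < t, q s = 1/2) → ∀ k < t, R1 k = R2 k := by
    intro t hs k
    induction k using Nat.strong_induction_on with
    | _ k ih =>
      intro hk
      have h1 := hDt k (fun s h => hs s (by omega)) (fun j hj => ih j hj (by omega))
      rw [hD0 k (hs k hk)] at h1
      have h2 := cnt_pos q k (fun s h => hs s (by omega))
      rcases mul_eq_zero.1 h1.symm with h | h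
      · exact absurd h h2.ne'
      · linarith
  by_cases hall : ∀ s, q s = 1/2
  · rw [hall t]
  · push Not at hall
    let t0 := Nat.find hall
    have ht0 : q t0 ≠ 1/2 := Nat.find_spec hall
    have hlt : ∀ s < t0, q s = 1/2 := fun s hs => not_not.1 (Nat.find_min hall hs)
    have hDpos : 0 < D t0 := by
      have h1 := hDt t0 hlt (hRs t0 hlt)
      have h2 := hopt t0 (hRs t0 hlt)
      have h3 : 0 ≤ D t0 := by
        rw [h1]; exact mul_nonneg (cnt_pos q t0 hlt).le (by linarith)
      refine lt_of_le_of_ne h3 fun h => ht0 ?_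
      rw [hq', ← h, htie]
    have hDall : ∀ s, t0 ≤ s → 0 < D s := by
      intro s hs
      induction s, hs using Nat.le_induction with
      | base => exact hDpos
      | succ s hs ih =>
        have hqs : q s = 1 := by rw [hq']; exact hHM.1 _ ih
        refine lt_of_lt_of_le ih ?_
        simp only [hD]
        rw [cnt_one_sum q s hqs (fun n _ => R1 n), cnt_one_sum q s hqs (fun _ m => R2 m)]
        refine sub_le_sub_right (Finset.sum_le_sum fun p _ => ?_) _
        exact mul_le_mul_of_nonneg_left (hmono _) (cnt_nonneg q s (fun r _ => hq01 r) _ _)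
    rcases lt_or_ge t t0 with h | h
    · rw [hlt t h]
    · rw [hq', hHM.1 _ (hDall t h)]; norm_num

end helpers

/-- **BayesGreedy guarantees at least half of the agents.**
Assume the `HardMax` response function with fair tie-breaking `fresp 0 = 1/2`.
If principal 1 chooses `BayesGreedy`, then regardless of principal 2's algorithm,
the expected number of agents who choose principal 1 is at least `T / 2`. -/
theorem hardMax_bayesGreedy_half_market
    {A : Type} [Fintype A] [Nonempty A]
    (P : Measure (A → ℝ)) [IsProbabilityMeasure P]
    (hcube : PriorOnUnitCube P)
    (hbest : EachArmCanBeBest P)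
    (hdistinct : DistinctPosteriorMeans P)
    (fresp : ℝ → ℝ) (hHM : IsHardMax fresp) (htie : fresp 0 = 1/2)
    (alg1 alg2 : Alg A) (hBG : IsBayesGreedy P alg1) (T : ℕ) :
    (T : ℝ) / 2 ≤ marketShare1 P alg1 alg2 fresp T := by
  have key : ∀ t, 1/2 ≤ qq P alg1 alg2 fresp t :=
    dyn fresp hHM htie _ (RR P alg1) (RR P alg2) (RR_mono P hcube hBG)
      (fun n hn => RR_opt P hcube hBG hdistinct alg2 n hn)
      (fun t => by rw [← next1 P hcube, ← next2 P hcube]; rfl)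
  have h := Finset.card_nsmul_le_sum (Finset.Icc 1 T)
    (fun t => probChoose1 P alg1 alg2 fresp t) (1/2) (fun t _ => key (t-1))
  simp only [Nat.card_Icc, Nat.add_sub_cancel, nsmul_eq_mul] at h
  unfold marketShare1
  linarith

end BayesianChoice
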